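/- arXiv:1907.01031 — 2 statements merged into one kernel-verified Lean document; each statement's English description precedes it below -/
import Mathlib

section
/- Let (N0,N1) be a partition of 𝒩 and let N be a nonempty subset of N1. Assume 0 ≤ q1 i ≤ qg i ≤ 1 and q1 i < 1 for every i ∈ 𝒩, qg i < 1 for every i ∈ N0, q1 i < qg i for every i ∈ N, and cs > 0. Then C(N0∪N, N1\N) < C(N0,N1) (i.e., no longer maintaining the components of N strictly reduces the total cost) if and only if Δ_s(N0,N1,N) > 1. -/
open Finset

variable {α : Type*}

/-- Two-stage expected total cost of a partition `(N0, N1)`: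
`C(N0,N1) = Σ_{i∈N1} cpm i + cs·[N1 ≠ ∅] + Σ_{i∈N0} qg i·ccm i + Σ_{i∈N1} q1 i·ccm i
  + cs·(1 − Π_{i∈N0}(1 − qg i)·Π_{i∈N1}(1 − q1 i))`. -/
noncomputable def cost (q1 qg cpm ccm : α → ℝ) (cs : ℝ) (N0 N1 : Finset α) : ℝ :=
  (∑ i ∈ N1, cpm i) + (if N1.Nonempty then cs else 0)
    + (∑ i ∈ N0, qg i * ccm i) + (∑ i ∈ N1, q1 i * ccm i)
    + cs * (1 - (∏ i ∈ N0, (1 - qg i)) * ∏ i ∈ N1, (1 - q1 i))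

/-- `ρ_k = (cpm k − (qg k − q1 k)·ccm k)/cs`. -/
noncomputable def rho (q1 qg cpm ccm : α → ℝ) (cs : ℝ) (k : α) : ℝ :=
  (cpm k - (qg k - q1 k) * ccm k) / cs

/-- `r_N = Π_{i∈N}(1 − q1 i)/(1 − qg i) − 1`. -/
noncomputable def rSet (q1 qg : α → ℝ) (N : Finset α) : ℝ :=
  (∏ i ∈ N, (1 - q1 i) / (1 - qg i)) - 1

/-- `s_N = 1 − Π_{i∈N}(1 − qg i)/(1 − q1 i)`. -/
noncomputable def sSet (q1 qg : α → ℝ) (N : Finset α) : ℝ :=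
  1 - ∏ i ∈ N, (1 - qg i) / (1 - q1 i)

/-- `p(N0,N1) = Π_{i∈N0}(1 − qg i)·Π_{i∈N1}(1 − q1 i)`. -/
noncomputable def pProb (q1 qg : α → ℝ) (N0 N1 : Finset α) : ℝ :=
  (∏ i ∈ N0, (1 - qg i)) * ∏ i ∈ N1, (1 - q1 i)

/-- `Δ_r(N0,N1,N)` for `N ⊆ N0`. -/
noncomputable def deltaR (q1 qg cpm ccm : α → ℝ) (cs : ℝ) (N0 N1 N : Finset α) : ℝ :=
  if N1.Nonempty then
    (∑ k ∈ N, rho q1 qg cpm ccm cs k) / (rSet q1 qg N * pProb q1 qg N0 N1)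
  else
    (1 + ∑ k ∈ N, rho q1 qg cpm ccm cs k) / (rSet q1 qg N * pProb q1 qg N0 N1)

/-- `Δ_s(N0,N1,N)` for `N ⊆ N1`. -/
noncomputable def deltaS [DecidableEq α] (q1 qg cpm ccm : α → ℝ) (cs : ℝ)
    (N0 N1 N : Finset α) : ℝ :=
  if (N1 \ N).Nonempty then
    (∑ k ∈ N, rho q1 qg cpm ccm cs k) / (sSet q1 qg N * pProb q1 qg N0 N1)
  else
    (1 + ∑ k ∈ N, rho q1 qg cpm ccm cs k) / (sSet q1 qg N * pProb q1 qg N0 N1)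

theorem sSet_pos (q1 qg : α → ℝ) {N : Finset α} (hNne : N.Nonempty)
    (hlt : ∀ i ∈ N, q1 i < qg i) (hqg : ∀ i ∈ N, qg i ≤ 1) : 0 < sSet q1 qg N := by
  classical
  have hpos : ∀ i ∈ N, 0 < 1 - q1 i := fun i hi => by linarith [hlt i hi, hqg i hi]
  have hnonneg : ∀ i ∈ N, 0 ≤ (1 - qg i) / (1 - q1 i) := fun i hi =>
    div_nonneg (by linarith [hqg i hi]) (hpos i hi).le
  have hlt_one : ∀ i ∈ N, (1 - qg i) / (1 - q1 i) < 1 := fun i hi =>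
    (div_lt_one (hpos i hi)).2 (by linarith [hlt i hi])
  obtain ⟨j, hj⟩ := hNne
  have hrest : ∏ i ∈ N.erase j, (1 - qg i) / (1 - q1 i) ≤ 1 :=
    Finset.prod_le_one (fun i hi => hnonneg i (Finset.mem_of_mem_erase hi))
      fun i hi => (hlt_one i (Finset.mem_of_mem_erase hi)).le
  rw [sSet, ← Finset.mul_prod_erase N _ hj, sub_pos]
  exact (mul_le_of_le_one_right (hnonneg j hj) hrest).trans_lt (hlt_one j hj)

theorem pProb_pos (q1 qg : α → ℝ) {N0 N1 : Finset α}
    (hqg : ∀ i ∈ N0, qg i < 1) (hq1 : ∀ i ∈ N1, q1 i < 1) : 0 < pProb q1 qg N0 N1 :=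
  mul_pos (Finset.prod_pos fun i hi => sub_pos.2 (hqg i hi))
    (Finset.prod_pos fun i hi => sub_pos.2 (hq1 i hi))

theorem pProb_union_sdiff [DecidableEq α] (q1 qg : α → ℝ) {N0 N1 N : Finset α}
    (hdisj : Disjoint N0 N1) (hN : N ⊆ N1) (hq1 : ∀ i ∈ N, q1 i < 1) :
    pProb q1 qg (N0 ∪ N) (N1 \ N) = (1 - sSet q1 qg N) * pProb q1 qg N0 N1 := by
  have hne : ∏ i ∈ N, (1 - q1 i) ≠ 0 :=
    (Finset.prod_pos fun i hi => sub_pos.2 (hq1 i hi)).ne'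
  rw [pProb, pProb, sSet, Finset.prod_union (hdisj.mono_right hN),
    ← Finset.prod_sdiff (f := fun i => 1 - q1 i) hN, Finset.prod_div_distrib]
  field_simp
  ring

/-- The saving obtained by no longer maintaining the components of `N`. -/
theorem cost_sub_cost_union_sdiff [DecidableEq α] (q1 qg cpm ccm : α → ℝ) {cs : ℝ}
    {N0 N1 N : Finset α} (hdisj : Disjoint N0 N1) (hN : N ⊆ N1) (hNne : N.Nonempty)
    (hq1 : ∀ i ∈ N, q1 i < 1) (hcs : cs ≠ 0) :
    cost q1 qg cpm ccm cs N0 N1 - cost q1 qg cpm ccm cs (N0 ∪ N) (N1 \ N) =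
      cs * ((if (N1 \ N).Nonempty then 0 else 1) + ∑ k ∈ N, rho q1 qg cpm ccm cs k
        - sSet q1 qg N * pProb q1 qg N0 N1) := by
  have hp := pProb_union_sdiff q1 qg hdisj hN hq1
  have hrho : cs * ∑ k ∈ N, rho q1 qg cpm ccm cs k =
      ∑ k ∈ N, cpm k - (∑ k ∈ N, qg k * ccm k - ∑ k ∈ N, q1 k * ccm k) := by
    simp only [rho, ← Finset.sum_div, Finset.sum_sub_distrib, sub_mul]
    field_simp
  simp only [pProb] at hp ⊢
  simp only [cost, if_pos (hNne.mono hN)]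
  rw [Finset.sum_union (hdisj.mono_right hN), ← Finset.sum_sdiff (f := cpm) hN,
    ← Finset.sum_sdiff (f := fun i => q1 i * ccm i) hN]
  split_ifs <;> linear_combination cs * hp - hrho

theorem prop3_iff [DecidableEq α]
    (q1 qg cpm ccm : α → ℝ) (cs : ℝ) (N0 N1 N : Finset α)
    (hdisj : Disjoint N0 N1) (hN : N ⊆ N1) (hNne : N.Nonempty)
    (hq : ∀ i ∈ N0 ∪ N1, 0 ≤ q1 i ∧ q1 i ≤ qg i ∧ qg i ≤ 1 ∧ q1 i < 1)
    (hqg0 : ∀ i ∈ N0, qg i < 1)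
    (hstrict : ∀ i ∈ N, q1 i < qg i)
    (hcs : 0 < cs) :
    cost q1 qg cpm ccm cs (N0 ∪ N) (N1 \ N) < cost q1 qg cpm ccm cs N0 N1 ↔
      deltaS q1 qg cpm ccm cs N0 N1 N > 1 := by
  have hlt1 : ∀ i ∈ N1, q1 i < 1 := fun i hi => (hq i (Finset.mem_union_right _ hi)).2.2.2
  have hqg : ∀ i ∈ N, qg i ≤ 1 := fun i hi => (hq i (Finset.mem_union_right _ (hN hi))).2.2.1
  have hsp : 0 < sSet q1 qg N * pProb q1 qg N0 N1 :=
    mul_pos (sSet_pos q1 qg hNne hstrict hqg) (pProb_pos q1 qg hqg0 hlt1)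
  rw [← sub_pos, cost_sub_cost_union_sdiff q1 qg cpm ccm hdisj hN hNne
    (fun i hi => hlt1 i (hN hi)) hcs.ne', mul_pos_iff_of_pos_left hcs, sub_pos, deltaS]
  split_ifs
  · rw [gt_iff_lt, one_lt_div hsp, zero_add]
  · rw [gt_iff_lt, one_lt_div hsp]
end

section
/- Let N0, N1 be disjoint finite sets of components, let S ⊆ N0, let k ∈ S, and set N = S\{k}. Assume qg i < 1 for all i ∈ N0. If Σ_{i∈N} ρ_i > r_N·p(N0,N1) and Σ_{i∈S} ρ_i < r_S·p(N0,N1), then ρ_k < r_{{k}}·p(N0\N, N1∪N). (This is the key inequality in Step 4 of the proof of Proposition 4: if no proper subset of S satisfies the improvement condition of Proposition 2 but S does, then the single component k satisfies it relative to the enlarged maintenance set.) -/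
open Finset

variable {α : Type*}

/-- Moving `N ⊆ N0` from the unmaintained to the maintained components multiplies the
probability of no failure by `r_N + 1`. -/
lemma pProb_sdiff_union [DecidableEq α] {q1 qg : α → ℝ} {N0 N1 N : Finset α}
    (hdisj : Disjoint N0 N1) (hN : N ⊆ N0) (hqg : ∀ i ∈ N, qg i ≠ 1) :
    pProb q1 qg (N0 \ N) (N1 ∪ N) = (rSet q1 qg N + 1) * pProb q1 qg N0 N1 := by
  have hne : ∏ i ∈ N, (1 - qg i) ≠ 0 :=
    Finset.prod_ne_zero_iff.mpr fun i hi => sub_ne_zero.mpr (hqg i hi).symm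
  have hunion : Disjoint N1 N := (Finset.disjoint_of_subset_left hN hdisj).symm
  unfold pProb rSet
  rw [Finset.prod_union hunion, Finset.prod_div_distrib,
    ← Finset.prod_sdiff (f := fun i => 1 - qg i) hN]
  field_simp
  ring

lemma rSet_add_one_eq_sdiff_mul [DecidableEq α] {q1 qg : α → ℝ} {S : Finset α} {k : α}
    (hk : k ∈ S) :
    rSet q1 qg S + 1 = (rSet q1 qg (S \ {k}) + 1) * (rSet q1 qg {k} + 1) := by
  simp only [rSet, sub_add_cancel]
  exact (Finset.prod_sdiff (Finset.singleton_subset_iff.mpr hk)).symm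

theorem prop4_step4_key [DecidableEq α]
    (q1 qg cpm ccm : α → ℝ) (cs : ℝ) (N0 N1 S : Finset α) (k : α)
    (hdisj : Disjoint N0 N1) (hS : S ⊆ N0) (hk : k ∈ S)
    (hqg : ∀ i ∈ N0, qg i < 1)
    (h1 : rSet q1 qg (S \ {k}) * pProb q1 qg N0 N1 <
      ∑ i ∈ S \ {k}, rho q1 qg cpm ccm cs i)
    (h2 : (∑ i ∈ S, rho q1 qg cpm ccm cs i) < rSet q1 qg S * pProb q1 qg N0 N1) :
    rho q1 qg cpm ccm cs k <
      rSet q1 qg {k} * pProb q1 qg (N0 \ (S \ {k})) (N1 ∪ (S \ {k})) := by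
  have hsum := Finset.sum_sdiff (f := rho q1 qg cpm ccm cs) (Finset.singleton_subset_iff.mpr hk)
  have hN : S \ {k} ⊆ N0 := Finset.sdiff_subset.trans hS
  rw [Finset.sum_singleton] at hsum
  rw [pProb_sdiff_union hdisj hN fun i hi => (hqg i (hN hi)).ne]
  rw [← hsum, eq_sub_of_add_eq (rSet_add_one_eq_sdiff_mul (q1 := q1) (qg := qg) hk)] at h2
  linarith
end
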